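/- arXiv:2211.11712 — 8 statements merged into one kernel-verified Lean document; each statement's English description precedes it below -/
import Mathlib

section
/- Let (C^•, ∂) be a cochain complex of real vector spaces whose cohomology spaces H^k(C) are all finite-dimensional, and let f be a chain map of degree 2 on C^•. Set b_k = dim H^k(C), r_k = rank([f] : H^k(C) → H^{k+2}(C)), and b_k^ω = dim H^k(Cone(f)). Then for every integer k, b_k^ω = b_k − r_{k−2} + b_{k−1} − r_{k−1}. -/
noncomputable section

open Module

namespace ConeMorse

variable {C : ℤ → Type} [∀ k, AddCommGroup (C k)] [∀ k, Module ℝ (C k)]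

/-- Transport along an equality of degrees. -/
def lcast {i j : ℤ} (h : i = j) : C i →ₗ[ℝ] C j := by subst h; exact LinearMap.id

lemma lcast_lcast {i j m : ℤ} (h1 : i = j) (h2 : j = m) (x : C i) :
    lcast h2 (lcast h1 x) = lcast (h1.trans h2) x := by subst h1; subst h2; rfl

lemma apply_lcast {ℓ : ℤ} (g : ∀ k, C k →ₗ[ℝ] C (k + ℓ)) {i j : ℤ} (h : i = j) (x : C i) :
    g j (lcast h x) = lcast (show i + ℓ = j + ℓ by rw [h]) (g i x) := by subst h; rfl

@[simp] lemma lcast_zero {i j : ℤ} (h : i = j) : lcast (C := C) h (0 : C i) = 0 := map_zero _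

lemma lcast_eq_zero_iff {i j : ℤ} (h : i = j) (x : C i) : lcast h x = 0 ↔ x = 0 := by
  subst h; exact Iff.rfl

/-- The coboundary map `C^{k-1} → C^k` of the complex `(C, d)`. -/
def bmap (d : ∀ k, C k →ₗ[ℝ] C (k + 1)) (k : ℤ) : C (k - 1) →ₗ[ℝ] C k :=
  (lcast (show k - 1 + 1 = k by ring)).comp (d (k - 1))

/-- The degree `k` cohomology of the cochain complex `(C, d)`:
cocycles modulo coboundaries. -/
abbrev coho (C : ℤ → Type) [∀ k, AddCommGroup (C k)] [∀ k, Module ℝ (C k)]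
    (d : ∀ k, C k →ₗ[ℝ] C (k + 1)) (k : ℤ) : Type :=
  ↥(LinearMap.ker (d k)) ⧸
    (LinearMap.range (bmap d k)).comap (LinearMap.ker (d k)).subtype

/-- `f` is a chain map of degree `ℓ` on the complex `(C, d)`, i.e. `∂ ∘ f = f ∘ ∂`. -/
def IsChainMap (d : ∀ k, C k →ₗ[ℝ] C (k + 1)) {ℓ : ℤ}
    (f : ∀ k, C k →ₗ[ℝ] C (k + ℓ)) : Prop :=
  ∀ k, (d (k + ℓ)).comp (f k) =
    (lcast (show k + 1 + ℓ = k + ℓ + 1 by ring)).comp ((f (k + 1)).comp (d k))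

/-- The degree `k` piece of the cone of a degree `ℓ` map: `C^k ⊕ C^{k-ℓ+1}`. -/
abbrev coneX (C : ℤ → Type) (ℓ : ℤ) : ℤ → Type := fun k => C k × C (k - ℓ + 1)

/-- The cone differential `d_C (x, y) = (∂ x + f y, - ∂ y)`. -/
def coneD (d : ∀ k, C k →ₗ[ℝ] C (k + 1)) {ℓ : ℤ} (f : ∀ k, C k →ₗ[ℝ] C (k + ℓ)) (k : ℤ) :
    coneX C ℓ k →ₗ[ℝ] coneX C ℓ (k + 1) :=
  LinearMap.prod
    ((d k).comp (LinearMap.fst ℝ (C k) (C (k - ℓ + 1))) +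
      ((lcast (show k - ℓ + 1 + ℓ = k + 1 by ring)).comp (f (k - ℓ + 1))).comp
        (LinearMap.snd ℝ (C k) (C (k - ℓ + 1))))
    (-(((lcast (show k - ℓ + 1 + 1 = k + 1 - ℓ + 1 by ring)).comp (d (k - ℓ + 1))).comp
        (LinearMap.snd ℝ (C k) (C (k - ℓ + 1)))))



@[simp] lemma coneD_apply (d : ∀ k, C k →ₗ[ℝ] C (k + 1)) {ℓ : ℤ}
    (f : ∀ k, C k →ₗ[ℝ] C (k + ℓ)) (k : ℤ) (x : C k) (y : C (k - ℓ + 1)) :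
    coneD d f k (x, y)
      = (d k x + lcast (show k - ℓ + 1 + ℓ = k + 1 by ring) (f (k - ℓ + 1) y),
         -(lcast (show k - ℓ + 1 + 1 = k + 1 - ℓ + 1 by ring) (d (k - ℓ + 1) y))) := rfl

lemma bmap_apply (d : ∀ k, C k →ₗ[ℝ] C (k + 1)) (k : ℤ) (x : C (k - 1)) :
    bmap d k x = lcast (show k - 1 + 1 = k by ring) (d (k - 1) x) := rfl

/-- A chain map of degree `ℓ` maps cocycles to cocycles. -/
def cocycleMap (d : ∀ k, C k →ₗ[ℝ] C (k + 1)) {ℓ : ℤ} (f : ∀ k, C k →ₗ[ℝ] C (k + ℓ))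
    (hf : IsChainMap d f) (k : ℤ) :
    ↥(LinearMap.ker (d k)) →ₗ[ℝ] ↥(LinearMap.ker (d (k + ℓ))) :=
  (f k).restrict (fun x hx => by
    have h := LinearMap.congr_fun (hf k) x
    simp only [LinearMap.comp_apply] at h
    simp only [LinearMap.mem_ker] at hx ⊢
    rw [h, hx, map_zero, map_zero])

/-- The map induced by a degree `ℓ` chain map on cohomology. -/
def inducedMap (d : ∀ k, C k →ₗ[ℝ] C (k + 1)) {ℓ : ℤ} (f : ∀ k, C k →ₗ[ℝ] C (k + ℓ))
    (hf : IsChainMap d f) (k : ℤ) : coho C d k →ₗ[ℝ] coho C d (k + ℓ) :=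
  Submodule.mapQ _ _ (cocycleMap d f hf k) (by
    intro z hz
    simp only [Submodule.mem_comap, Submodule.coe_subtype, LinearMap.mem_range] at hz ⊢
    obtain ⟨y, hy⟩ := hz
    refine ⟨lcast (show k - 1 + ℓ = k + ℓ - 1 by ring) (f (k - 1) y), ?_⟩
    have hco : ((cocycleMap d f hf k z : ↥(LinearMap.ker (d (k + ℓ)))) : C (k + ℓ))
        = f k (z : C k) := rfl
    rw [hco, ← hy]
    show bmap d (k + ℓ) _ = f k (bmap d k y)
    unfold bmap
    simp only [LinearMap.comp_apply]
    rw [apply_lcast (ℓ := 1) d, apply_lcast f, lcast_lcast]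
    have h := LinearMap.congr_fun (hf (k - 1)) y
    simp only [LinearMap.comp_apply] at h
    rw [h, lcast_lcast])


/-- Identification of cohomology in equal degrees. -/
def cohoCast (d : ∀ k, C k →ₗ[ℝ] C (k + 1)) {i j : ℤ} (h : i = j) :
    coho C d i →ₗ[ℝ] coho C d j := by subst h; exact LinearMap.id

/-- The map `[f] : H^i(C) → H^j(C)` (with `j = i + ℓ`) induced on cohomology by a
degree `ℓ` chain map `f`. -/
def inducedMap' (d : ∀ k, C k →ₗ[ℝ] C (k + 1)) {ℓ : ℤ} (f : ∀ k, C k →ₗ[ℝ] C (k + ℓ))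
    (hf : IsChainMap d f) (i j : ℤ) (h : i + ℓ = j) : coho C d i →ₗ[ℝ] coho C d j :=
  (cohoCast d h).comp (inducedMap d f hf i)

lemma coneX_lcast {ℓ : ℤ} {i j : ℤ} (h : i = j) (x : C i) (y : C (i - ℓ + 1)) :
    lcast (C := coneX C ℓ) h (x, y)
      = (lcast h x, lcast (show i - ℓ + 1 = j - ℓ + 1 by rw [h]) y) := by
  subst h; rfl


/-- The map `[ι] : H^k(C) → H^k(Cone f)` induced by the inclusion `x ↦ (x, 0)`. -/
def inducedIota (d : ∀ k, C k →ₗ[ℝ] C (k + 1)) {ℓ : ℤ} (f : ∀ k, C k →ₗ[ℝ] C (k + ℓ))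
    (hf : IsChainMap d f) (k : ℤ) :
    coho C d k →ₗ[ℝ] coho (coneX C ℓ) (coneD d f) k :=
  Submodule.mapQ _ _ ((LinearMap.inl ℝ (C k) (C (k - ℓ + 1))).restrict (fun x hx => by
      simp only [LinearMap.mem_ker] at hx ⊢
      simp only [LinearMap.inl_apply]
      simp [coneD, hx, Prod.ext_iff]))
    (by
      intro z hz
      simp only [Submodule.mem_comap, Submodule.coe_subtype, LinearMap.mem_range] at hz ⊢
      obtain ⟨y, hy⟩ := hz
      refine ⟨(y, 0), ?_⟩
      show bmap (coneD d f) k (y, 0) = ((z : C k), (0 : C (k - ℓ + 1)))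
      have h1 : coneD d f (k - 1) (y, 0) = (d (k - 1) y, 0) := by
        simp [coneD, Prod.ext_iff]
      show lcast (C := coneX C ℓ) _ (coneD d f (k - 1) (y, 0)) = _
      rw [h1, coneX_lcast, ← hy]
      exact Prod.ext rfl (by simp))

/-- The map `[π] : H^k(Cone f) → H^{k-ℓ+1}(C)` induced by the projection `(x, y) ↦ y`. -/
def inducedPi (d : ∀ k, C k →ₗ[ℝ] C (k + 1)) {ℓ : ℤ} (f : ∀ k, C k →ₗ[ℝ] C (k + ℓ))
    (hf : IsChainMap d f) (k : ℤ) :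
    coho (coneX C ℓ) (coneD d f) k →ₗ[ℝ] coho C d (k - ℓ + 1) :=
  Submodule.mapQ _ _ ((LinearMap.snd ℝ (C k) (C (k - ℓ + 1))).restrict (fun x hx => by
      obtain ⟨x1, x2⟩ := x
      simp only [LinearMap.mem_ker] at hx ⊢
      have h2 := congrArg Prod.snd hx
      rw [coneD_apply] at h2
      simp only [Prod.snd_zero, neg_eq_zero, lcast_eq_zero_iff] at h2
      simpa using h2))
    (by
      intro z hz
      simp only [Submodule.mem_comap, Submodule.coe_subtype, LinearMap.mem_range] at hz ⊢
      obtain ⟨⟨w1, w2⟩, hw⟩ := hz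
      refine ⟨-(lcast (show k - 1 - ℓ + 1 = k - ℓ + 1 - 1 by ring) w2), ?_⟩
      have h2 := congrArg Prod.snd hw
      rw [bmap_apply, coneD_apply, coneX_lcast] at h2
      simp only [map_neg, lcast_lcast] at h2
      show bmap d (k - ℓ + 1) _ = ((z : coneX C ℓ k)).2
      rw [← h2, bmap_apply, map_neg, map_neg, apply_lcast (ℓ := 1) d, lcast_lcast])


lemma lcast_rfl {i : ℤ} (h : i = i) (x : C i) : lcast h x = x := rfl

lemma iMap_mk_eq (d : ∀ k, C k →ₗ[ℝ] C (k + 1)) {ℓ : ℤ} (f : ∀ k, C k →ₗ[ℝ] C (k + ℓ))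
    (hf : IsChainMap d f) (i j : ℤ) (h : i + ℓ = j) (z : LinearMap.ker (d i))
    (z' : LinearMap.ker (d j)) :
    inducedMap' d f hf i j h (Submodule.Quotient.mk z) = Submodule.Quotient.mk z' ↔
      ∃ w, bmap d j w = lcast h (f i z) - z' := by
  subst h
  show (Submodule.Quotient.mk (cocycleMap d f hf i z) : coho C d (i + ℓ)) = _ ↔ _
  rw [Submodule.Quotient.eq]
  exact Iff.rfl

lemma iota_mk_eq_zero (d : ∀ k, C k →ₗ[ℝ] C (k + 1)) {ℓ : ℤ} (f : ∀ k, C k →ₗ[ℝ] C (k + ℓ))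
    (hf : IsChainMap d f) (k : ℤ) (z : LinearMap.ker (d k)) :
    inducedIota d f hf k (Submodule.Quotient.mk z) = 0 ↔
      ∃ w, bmap (coneD d f) k w = ((z : C k), (0 : C (k - ℓ + 1))) := by
  unfold inducedIota
  rw [Submodule.mapQ_apply, Submodule.Quotient.mk_eq_zero]
  exact Iff.rfl

lemma bmap_cone (d : ∀ k, C k →ₗ[ℝ] C (k + 1)) {ℓ : ℤ} (f : ∀ k, C k →ₗ[ℝ] C (k + ℓ))
    (k : ℤ) (x : C (k - 1)) (y : C (k - 1 - ℓ + 1)) :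
    bmap (coneD d f) k (x, y) = (bmap d k x + lcast (by ring) (f _ y),
      - lcast (by ring) (d _ y)) := by
  rw [bmap_apply, coneD_apply, coneX_lcast]
  simp only [map_add, map_neg, lcast_lcast, bmap_apply]

lemma ker_iota (d : ∀ k, C k →ₗ[ℝ] C (k + 1)) {ℓ : ℤ} (f : ∀ k, C k →ₗ[ℝ] C (k + ℓ))
    (hf : IsChainMap d f) (k : ℤ) :
    LinearMap.ker (inducedIota d f hf k) =
      LinearMap.range (inducedMap' d f hf (k - ℓ) k (by ring)) := by
  ext x
  obtain ⟨z, rfl⟩ := Submodule.Quotient.mk_surjective _ x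
  rw [LinearMap.mem_ker, iota_mk_eq_zero, LinearMap.mem_range]
  constructor
  · rintro ⟨⟨w1, w2⟩, hw⟩
    rw [bmap_cone, Prod.ext_iff] at hw
    obtain ⟨h1, h2⟩ := hw
    simp only [neg_eq_zero, lcast_eq_zero_iff] at h1 h2
    refine ⟨Submodule.Quotient.mk ⟨lcast (show k - 1 - ℓ + 1 = k - ℓ by ring) w2, ?_⟩, ?_⟩
    · rw [LinearMap.mem_ker, apply_lcast (ℓ := 1) d, h2, lcast_zero]
    · rw [iMap_mk_eq]
      refine ⟨-w1, ?_⟩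
      rw [← h1, apply_lcast f, lcast_lcast, map_neg]
      abel
  · rintro ⟨y, hy⟩
    obtain ⟨y, rfl⟩ := Submodule.Quotient.mk_surjective _ y
    rw [iMap_mk_eq] at hy
    obtain ⟨w, hw⟩ := hy
    refine ⟨(-w, lcast (show k - ℓ = k - 1 - ℓ + 1 by ring) (y : C (k - ℓ))), ?_⟩
    have hy0 : d _ (y : C (k - ℓ)) = 0 := y.2
    rw [bmap_cone, apply_lcast f, apply_lcast (ℓ := 1) d, hy0, map_neg, hw, lcast_lcast]
    simp

lemma ker_pi (d : ∀ k, C k →ₗ[ℝ] C (k + 1)) {ℓ : ℤ} (f : ∀ k, C k →ₗ[ℝ] C (k + ℓ))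
    (hd : ∀ k, (d (k + 1)).comp (d k) = 0)
    (hf : IsChainMap d f) (k : ℤ) :
    LinearMap.ker (inducedPi d f hf k) = LinearMap.range (inducedIota d f hf k) := by
  ext x
  obtain ⟨⟨⟨a, b⟩, hz⟩, rfl⟩ := Submodule.Quotient.mk_surjective _ x
  have hz' := hz
  rw [LinearMap.mem_ker, coneD_apply, Prod.ext_iff] at hz'
  obtain ⟨h1, h2⟩ := hz'
  have hpi : Submodule.Quotient.mk ⟨(a, b), hz⟩ ∈ LinearMap.ker (inducedPi d f hf k) ↔
      ∃ w, bmap d (k - ℓ + 1) w = b := by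
    rw [LinearMap.mem_ker]
    unfold inducedPi
    rw [Submodule.mapQ_apply, Submodule.Quotient.mk_eq_zero]
    exact Iff.rfl
  have hio : ∀ y : LinearMap.ker (d k), inducedIota d f hf k (Submodule.Quotient.mk y) =
      Submodule.Quotient.mk ⟨(a, b), hz⟩ ↔
      ∃ w, bmap (coneD d f) k w = ((y : C k) - a, 0 - b) := by
    intro y
    unfold inducedIota
    rw [Submodule.mapQ_apply, Submodule.Quotient.eq]
    exact Iff.rfl
  rw [hpi, LinearMap.mem_range]
  constructor
  · rintro ⟨w, hw⟩
    have e : d k (a + lcast (by ring) (f _ w)) = 0 := by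
      have h := LinearMap.congr_fun (hf (k - ℓ + 1 - 1)) w
      simp only [LinearMap.comp_apply] at h
      rw [← hw, bmap_apply, apply_lcast f, lcast_lcast] at h1
      rw [map_add, apply_lcast (ℓ := 1) d, h, lcast_lcast]
      exact h1
    refine ⟨Submodule.Quotient.mk ⟨a + lcast (by ring) (f _ w), e⟩, ?_⟩
    rw [hio]
    refine ⟨(0, lcast (by ring) w), ?_⟩
    rw [bmap_cone, apply_lcast f, apply_lcast (ℓ := 1) d, ← hw, bmap_apply, lcast_lcast,
      lcast_lcast]
    simp [bmap_apply]
  · rintro ⟨y, hy⟩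
    obtain ⟨y, rfl⟩ := Submodule.Quotient.mk_surjective _ y
    rw [hio] at hy
    obtain ⟨⟨w1, w2⟩, hw⟩ := hy
    rw [bmap_cone, Prod.ext_iff] at hw
    have := hw.2
    simp only [zero_sub, neg_inj] at this
    refine ⟨lcast (by ring) w2, ?_⟩
    rw [← this, bmap_apply, apply_lcast (ℓ := 1) d, lcast_lcast]

lemma range_pi (d : ∀ k, C k →ₗ[ℝ] C (k + 1)) {ℓ : ℤ} (f : ∀ k, C k →ₗ[ℝ] C (k + ℓ))
    (hf : IsChainMap d f) (k : ℤ) :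
    LinearMap.range (inducedPi d f hf k) =
      LinearMap.ker (inducedMap' d f hf (k - ℓ + 1) (k + 1) (by ring)) := by
  ext x
  obtain ⟨z, rfl⟩ := Submodule.Quotient.mk_surjective _ x
  have hz : d _ (z : C (k - ℓ + 1)) = 0 := z.2
  have hm := iMap_mk_eq d f hf (k - ℓ + 1) (k + 1) (by ring) z 0
  rw [Submodule.Quotient.mk_zero] at hm
  rw [LinearMap.mem_ker, hm, LinearMap.mem_range]
  have hpi : ∀ y : LinearMap.ker (coneD d f k),
      inducedPi d f hf k (Submodule.Quotient.mk y) = Submodule.Quotient.mk z ↔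
      ∃ w, bmap d (k - ℓ + 1) w = (y : coneX C ℓ k).2 - z := by
    intro y
    unfold inducedPi
    rw [Submodule.mapQ_apply, Submodule.Quotient.eq]
    exact Iff.rfl
  constructor
  · rintro ⟨y, hy⟩
    obtain ⟨⟨⟨a, b⟩, hz⟩, rfl⟩ := Submodule.Quotient.mk_surjective _ y
    rw [hpi] at hy
    obtain ⟨w, hw⟩ := hy
    have hz' := hz
    rw [LinearMap.mem_ker, coneD_apply, Prod.ext_iff] at hz'
    have h1 := hz'.1
    have h := LinearMap.congr_fun (hf (k - ℓ + 1 - 1)) w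
    simp only [LinearMap.comp_apply] at h
    have hzb : (z : C (k - ℓ + 1)) = b - bmap d (k - ℓ + 1) w := by rw [hw]; simp
    refine ⟨-lcast (by ring) a - lcast (by ring) (f _ w), ?_⟩
    rw [hzb, bmap_apply, bmap_apply, map_sub, map_sub, map_sub, map_sub, map_neg, map_neg,
      apply_lcast (ℓ := 1) d, apply_lcast (ℓ := 1) d, apply_lcast f, h]
    simp only [lcast_lcast, lcast_rfl]
    rw [neg_eq_of_add_eq_zero_right h1]
    simp
  · rintro ⟨w, hw⟩
    refine ⟨Submodule.Quotient.mk ⟨(-lcast (by ring) w, z), ?_⟩, ?_⟩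
    · rw [LinearMap.mem_ker, coneD_apply, hz, map_neg, apply_lcast (ℓ := 1) d]
      rw [bmap_apply] at hw
      rw [hw]
      simp
    · rfl

lemma finrank_range_congr (d : ∀ k, C k →ₗ[ℝ] C (k + 1)) {ℓ : ℤ}
    (f : ∀ k, C k →ₗ[ℝ] C (k + ℓ)) (hf : IsChainMap d f) {i i' j : ℤ} (e : i = i')
    (h : i + ℓ = j) (h' : i' + ℓ = j) :
    finrank ℝ (LinearMap.range (inducedMap' d f hf i j h)) =
      finrank ℝ (LinearMap.range (inducedMap' d f hf i' j h')) := by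
  subst e; rfl

/-- If the cohomology of `(C, ∂)` is finite-dimensional and `f` is a degree `2`
chain map, then `dim H^k(Cone f) = b_k - r_{k-2} + b_{k-1} - r_{k-1}`, where
`b_k = dim H^k(C)` and `r_k = rank([f] : H^k(C) → H^{k+2}(C))`. -/
theorem cone_cohomology_dimension_formula
    (C : ℤ → Type) [∀ k, AddCommGroup (C k)] [∀ k, Module ℝ (C k)]
    (d : ∀ k, C k →ₗ[ℝ] C (k + 1)) (hd : ∀ k, (d (k + 1)).comp (d k) = 0)
    (f : ∀ k, C k →ₗ[ℝ] C (k + 2)) (hf : IsChainMap d f)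
    (hfin : ∀ k : ℤ, FiniteDimensional ℝ (coho C d k)) (k : ℤ) :
    (finrank ℝ (coho (coneX C 2) (coneD d f) k) : ℤ)
      = (finrank ℝ (coho C d k) : ℤ)
        - finrank ℝ ↥(LinearMap.range (inducedMap' d f hf (k - 2) k (by ring)))
        + finrank ℝ (coho C d (k - 1))
        - finrank ℝ ↥(LinearMap.range (inducedMap' d f hf (k - 1) (k + 1) (by ring))) := by
  have e1 := LinearMap.finrank_range_add_finrank_ker (inducedIota d f hf k)
  have e2 := LinearMap.finrank_range_add_finrank_ker
    (inducedMap' d f hf (k - 2 + 1) (k + 1) (by ring))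
  have hfc : FiniteDimensional ℝ (coho (coneX C 2) (coneD d f) k) := by
    have h1 : FiniteDimensional ℝ (LinearMap.ker (inducedPi d f hf k)) := by
      rw [ker_pi d f hd hf k]; infer_instance
    have h2 : FiniteDimensional ℝ
        (coho (coneX C 2) (coneD d f) k ⧸ LinearMap.ker (inducedPi d f hf k)) :=
      Module.Finite.equiv (inducedPi d f hf k).quotKerEquivRange.symm
    exact Module.Finite.of_submodule_quotient (LinearMap.ker (inducedPi d f hf k))
  have e3 := LinearMap.finrank_range_add_finrank_ker (inducedPi d f hf k)
  rw [ker_iota] at e1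
  rw [ker_pi d f hd hf k, range_pi] at e3
  rw [finrank_range_congr d f hf (show k - 2 + 1 = k - 1 by ring) _ (by ring)] at e2
  have e4 : finrank ℝ (coho C d (k - 2 + 1)) = finrank ℝ (coho C d (k - 1)) := by
    rw [show k - 2 + 1 = k - 1 by ring]
  omega

end ConeMorse
end
end

section
/- (Weak cone Morse inequalities, algebraic form.) Let (C^•, ∂) be a cochain complex of finite-dimensional real vector spaces and let f be a chain map of degree 2 on C^•. Set m_k = dim C^k, v_k = rank(f : C^k → C^{k+2}), and b_k^ω = dim H^k(Cone(f)). Then for every integer k, b_k^ω ≤ m_k − v_{k−2} + m_{k−1} − v_{k−1}. -/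
noncomputable section

open Module

namespace ConeMorse

variable {C : ℤ → Type} [∀ k, AddCommGroup (C k)] [∀ k, Module ℝ (C k)]

lemma rank_coneD_ge [∀ k, FiniteDimensional ℝ (C k)]
    (d : ∀ k, C k →ₗ[ℝ] C (k + 1)) (f : ∀ k, C k →ₗ[ℝ] C (k + 2)) (i j : ℤ)
    (h : i = j - 2 + 1) :
    finrank ℝ ↥(LinearMap.range (f i)) ≤ finrank ℝ ↥(LinearMap.range (coneD d f j)) := by
  subst h
  have e : f (j - 2 + 1) = (lcast (C := C) (show j + 1 = j - 2 + 1 + 2 by ring)).comp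
      ((LinearMap.fst ℝ (C (j + 1)) (C (j + 1 - 2 + 1))).comp
        ((coneD d f j).comp (LinearMap.inr ℝ (C j) (C (j - 2 + 1))))) := by
    ext y
    simp only [LinearMap.comp_apply, LinearMap.inr_apply, coneD_apply, map_zero, zero_add,
      LinearMap.fst_apply, lcast_lcast]
    rfl
  rw [e, LinearMap.range_comp, LinearMap.range_comp]
  refine (Submodule.finrank_map_le _ _).trans ((Submodule.finrank_map_le _ _).trans ?_)
  exact Submodule.finrank_mono (LinearMap.range_comp_le_range _ _)

lemma lcast_injective {i j : ℤ} (h : i = j) :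
    Function.Injective (lcast (C := C) h) := by
  subst h; exact fun _ _ h => h

lemma coneD_coneD (d : ∀ k, C k →ₗ[ℝ] C (k + 1)) (hd : ∀ k, (d (k + 1)).comp (d k) = 0)
    {ℓ : ℤ} (f : ∀ k, C k →ₗ[ℝ] C (k + ℓ)) (hf : IsChainMap d f) (k : ℤ)
    (z : coneX C ℓ k) : coneD d f (k + 1) (coneD d f k z) = 0 := by
  obtain ⟨x, y⟩ := z
  have hd' : ∀ k x, d (k + 1) (d k x) = 0 := fun k x => LinearMap.congr_fun (hd k) x
  have h := LinearMap.congr_fun (hf (k - ℓ + 1)) y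
  simp only [LinearMap.comp_apply] at h
  rw [coneD_apply, coneD_apply]
  simp only [map_add, map_neg, hd', zero_add, apply_lcast (ℓ := 1) d, apply_lcast f, h,
    lcast_lcast, lcast_zero, add_neg_cancel, neg_zero]
  rfl

/-- weak cone Morse inequalities, algebraic form: for a degree `2` chain map
`f` on a cochain complex of finite-dimensional real vector spaces,
`b_k^ω ≤ m_k - v_{k-2} + m_{k-1} - v_{k-1}`, where `m_k = dim C^k`,
`v_k = rank(f : C^k → C^{k+2})` and `b_k^ω = dim H^k(Cone f)`. -/
theorem weak_cone_morse_inequalities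
    (C : ℤ → Type) [∀ k, AddCommGroup (C k)] [∀ k, Module ℝ (C k)]
    [∀ k, FiniteDimensional ℝ (C k)]
    (d : ∀ k, C k →ₗ[ℝ] C (k + 1)) (hd : ∀ k, (d (k + 1)).comp (d k) = 0)
    (f : ∀ k, C k →ₗ[ℝ] C (k + 2)) (hf : IsChainMap d f) (k : ℤ) :
    (finrank ℝ (coho (coneX C 2) (coneD d f) k) : ℤ)
      ≤ (finrank ℝ (C k) : ℤ) - finrank ℝ ↥(LinearMap.range (f (k - 2)))
        + finrank ℝ (C (k - 1)) - finrank ℝ ↥(LinearMap.range (f (k - 1))) := by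
  have hle : LinearMap.range (bmap (coneD d f) k) ≤ LinearMap.ker (coneD d f k) := by
    rintro _ ⟨z, rfl⟩
    rw [LinearMap.mem_ker, bmap_apply, apply_lcast (C := coneX C 2) (ℓ := 1) (coneD d f),
      coneD_coneD d hd f hf, map_zero]
  have h1 : finrank ℝ (coho (coneX C 2) (coneD d f) k) + finrank ℝ
      ↥((LinearMap.range (bmap (coneD d f) k)).comap (LinearMap.ker (coneD d f k)).subtype)
      = finrank ℝ ↥(LinearMap.ker (coneD d f k)) := Submodule.finrank_quotient_add_finrank
    ((LinearMap.range (bmap (coneD d f) k)).comap (LinearMap.ker (coneD d f k)).subtype)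
  have h2 := (Submodule.comapSubtypeEquivOfLe hle).finrank_eq
  have h3 := LinearMap.finrank_range_add_finrank_ker (coneD d f k)
  have h4 : finrank ℝ ↥(LinearMap.range (bmap (coneD d f) k))
      = finrank ℝ ↥(LinearMap.range (coneD d f (k - 1))) := by
    unfold bmap
    rw [LinearMap.range_comp]
    exact (Submodule.equivMapOfInjective _ (lcast_injective (C := coneX C 2) _) _).finrank_eq.symm
  have h5 := rank_coneD_ge d f (k - 1) k (by ring)
  have h6 := rank_coneD_ge d f (k - 2) (k - 1) (by ring)
  have h7 : finrank ℝ (coneX C 2 k) = finrank ℝ (C k) + finrank ℝ (C (k - 1)) := by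
    have : k - 2 + 1 = k - 1 := by ring
    rw [← this]
    exact Module.finrank_prod
  rw [h2] at h1
  omega

end ConeMorse
end
end

section
/- (Strong cone Morse inequalities, algebraic form.) Let (C^•, ∂) be a cochain complex of finite-dimensional real vector spaces with C^k = 0 for k < 0, and let f be a chain map of degree 2 on C^•. Set m_k = dim C^k, v_k = rank(f : C^k → C^{k+2}), and b_k^ω = dim H^k(Cone(f)). Then for every k ≥ 0, ∑_{i=0}^{k} (−1)^{k−i} b_i^ω ≤ m_k − v_{k−1}. -/
noncomputable section

open Module

namespace ConeMorse

variable {C : ℤ → Type} [∀ k, AddCommGroup (C k)] [∀ k, Module ℝ (C k)]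

lemma finrank_map_eq_aux {V W : Type} [AddCommGroup V] [Module ℝ V] [AddCommGroup W] [Module ℝ W]
    (g : V →ₗ[ℝ] W) (hg : Function.Injective g) (p : Submodule ℝ V) :
    finrank ℝ (p.map g) = finrank ℝ p :=
  ((Submodule.equivMapOfInjective g hg p).finrank_eq).symm

lemma aux_coneD_sq (d : ∀ k, C k →ₗ[ℝ] C (k + 1)) (hd : ∀ k, (d (k + 1)).comp (d k) = 0)
    (f : ∀ k, C k →ₗ[ℝ] C (k + 2)) (hf : IsChainMap d f) (k : ℤ) (z : coneX C 2 k) :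
    coneD d f (k + 1) (coneD d f k z) = 0 := by
  obtain ⟨x, y⟩ := z
  have h0 : ∀ (k : ℤ) (x : C k), d (k + 1) (d k x) = 0 := fun k x => LinearMap.congr_fun (hd k) x
  have h1 := LinearMap.congr_fun (hf (k - 2 + 1)) y
  simp only [LinearMap.comp_apply] at h1
  rw [coneD_apply, coneD_apply]
  simp only [map_add, map_neg, h0, zero_add]
  rw [apply_lcast (ℓ := 1) d, apply_lcast (ℓ := 1) d, apply_lcast f, h0, h1]
  simp only [lcast_lcast, lcast_zero, neg_zero, add_neg_cancel]
  rfl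

lemma aux_range_bmap (d : ∀ k, C k →ₗ[ℝ] C (k + 1)) (i j : ℤ) (h : i + 1 = j) :
    finrank ℝ (LinearMap.range (bmap d j)) = finrank ℝ (LinearMap.range (d i)) := by
  obtain rfl : i = j - 1 := by omega
  have hl : ∀ {a b : ℤ} (h : a = b), Function.Injective (lcast (C := C) h) := by
    intro a b h; subst h; exact fun _ _ h => h
  unfold bmap
  rw [LinearMap.range_comp]
  exact finrank_map_eq_aux _ (hl _) _

lemma aux_coho [∀ k, FiniteDimensional ℝ (C k)] (d : ∀ k, C k →ₗ[ℝ] C (k + 1))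
    (hd : ∀ k x, d (k + 1) (d k x) = 0) (i j : ℤ) (h : i + 1 = j) :
    finrank ℝ (coho C d j) + finrank ℝ (LinearMap.range (d i)) + finrank ℝ (LinearMap.range (d j))
      = finrank ℝ (C j) := by
  have hle : LinearMap.range (bmap d j) ≤ LinearMap.ker (d j) := by
    rintro _ ⟨x, rfl⟩
    rw [LinearMap.mem_ker, bmap_apply, apply_lcast (ℓ := 1) d, hd, lcast_zero]
  have h1 := Submodule.finrank_quotient_add_finrank
    ((LinearMap.range (bmap d j)).comap (LinearMap.ker (d j)).subtype)
  have h2 := (Submodule.comapSubtypeEquivOfLe hle).finrank_eq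
  have h3 := LinearMap.finrank_range_add_finrank_ker (d j)
  have h4 := aux_range_bmap d i j h
  unfold coho
  omega

lemma aux_rank [∀ k, FiniteDimensional ℝ (C k)] (d : ∀ k, C k →ₗ[ℝ] C (k + 1))
    (f : ∀ k, C k →ₗ[ℝ] C (k + 2)) (k i : ℤ) (h : k - 2 + 1 = i) :
    finrank ℝ (LinearMap.range (f i)) ≤ finrank ℝ (LinearMap.range (coneD d f k)) := by
  subst h
  have hl : ∀ {a b : ℤ} (h : a = b), Function.Injective (lcast (C := C) h) := by
    intro a b h; subst h; exact fun _ _ h => h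
  have e : k - 2 + 1 + 2 = k + 1 := by ring
  rw [← finrank_map_eq_aux (lcast (C := C) e) (hl e) (LinearMap.range (f (k - 2 + 1)))]
  refine le_trans (Submodule.finrank_mono ?_)
    (Submodule.finrank_map_le (LinearMap.fst ℝ (C (k + 1)) (C (k + 1 - 2 + 1)))
      (LinearMap.range (coneD d f k)))
  rintro _ ⟨_, ⟨y, rfl⟩, rfl⟩
  refine ⟨_, ⟨(0, y), rfl⟩, ?_⟩
  rw [coneD_apply]
  simp

lemma aux_sum [∀ k, FiniteDimensional ℝ (C k)]
    (hneg : ∀ k : ℤ, k < 0 → Subsingleton (C k))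
    (d : ∀ k, C k →ₗ[ℝ] C (k + 1)) (hd : ∀ k, (d (k + 1)).comp (d k) = 0)
    (f : ∀ k, C k →ₗ[ℝ] C (k + 2)) (hf : IsChainMap d f) (k : ℕ) :
    ∑ i ∈ Finset.range (k + 1),
        (-1 : ℤ) ^ (k - i) * (finrank ℝ (coho (coneX C 2) (coneD d f) (i : ℤ)) : ℤ)
      = (finrank ℝ (C (k : ℤ)) : ℤ) - finrank ℝ (LinearMap.range (coneD d f k)) := by
  have hc := fun i j h => aux_coho (C := coneX C 2) (coneD d f) (aux_coneD_sq d hd f hf) i j h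
  have hdim : ∀ i j : ℤ, i + 1 = j →
      finrank ℝ (coneX C 2 j) = finrank ℝ (C j) + finrank ℝ (C i) := by
    intro i j h
    obtain rfl : i = j - 2 + 1 := by omega
    exact Module.finrank_prod
  induction k with
  | zero =>
    have h1 := hc (-1) ((0 : ℕ) : ℤ) (by norm_num)
    have h2 := hdim (-1) ((0 : ℕ) : ℤ) (by norm_num)
    have := hneg (-1) (by norm_num)
    have := hneg (-1 - 2 + 1) (by norm_num)
    have h3 : finrank ℝ (C (-1)) = 0 := finrank_zero_of_subsingleton
    have h4 : finrank ℝ (LinearMap.range (coneD d f (-1))) = 0 := by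
      have := LinearMap.finrank_range_le (coneD d f (-1))
      have h5 : finrank ℝ (coneX C 2 (-1)) = 0 := finrank_zero_of_subsingleton
      omega
    simp only [zero_add, Finset.sum_range_one, Nat.sub_zero, pow_zero, one_mul]
    omega
  | succ k ih =>
    rw [Finset.sum_range_succ]
    have hs : ∑ i ∈ Finset.range (k + 1), (-1 : ℤ) ^ (k + 1 - i) *
          (finrank ℝ (coho (coneX C 2) (coneD d f) (i : ℤ)) : ℤ)
        = - ∑ i ∈ Finset.range (k + 1), (-1 : ℤ) ^ (k - i) *
          (finrank ℝ (coho (coneX C 2) (coneD d f) (i : ℤ)) : ℤ) := by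
      rw [← Finset.sum_neg_distrib]
      refine Finset.sum_congr rfl fun i hi => ?_
      rw [Nat.succ_sub (Nat.lt_succ_iff.mp (Finset.mem_range.mp hi)), pow_succ]
      ring
    rw [hs, ih]
    have h1 := hc k ((k + 1 : ℕ) : ℤ) (by push_cast; ring)
    have h2 := hdim k ((k + 1 : ℕ) : ℤ) (by push_cast; ring)
    simp only [Nat.sub_self, pow_zero, one_mul]
    omega

/-- strong cone Morse inequalities, algebraic form: for a degree `2` chain map
`f` on a cochain complex of finite-dimensional real vector spaces vanishing in negative
degrees, `∑_{i=0}^{k} (-1)^{k-i} b_i^ω ≤ m_k - v_{k-1}` for every `k ≥ 0`, where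
`m_k = dim C^k`, `v_k = rank(f : C^k → C^{k+2})` and `b_k^ω = dim H^k(Cone f)`. -/
theorem strong_cone_morse_inequalities
    (C : ℤ → Type) [∀ k, AddCommGroup (C k)] [∀ k, Module ℝ (C k)]
    [∀ k, FiniteDimensional ℝ (C k)]
    (hneg : ∀ k : ℤ, k < 0 → Subsingleton (C k))
    (d : ∀ k, C k →ₗ[ℝ] C (k + 1)) (hd : ∀ k, (d (k + 1)).comp (d k) = 0)
    (f : ∀ k, C k →ₗ[ℝ] C (k + 2)) (hf : IsChainMap d f) (k : ℕ) :
    ∑ i ∈ Finset.range (k + 1),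
        (-1 : ℤ) ^ (k - i) * (finrank ℝ (coho (coneX C 2) (coneD d f) (i : ℤ)) : ℤ)
      ≤ (finrank ℝ (C (k : ℤ)) : ℤ)
        - finrank ℝ ↥(LinearMap.range (f ((k : ℤ) - 1))) := by
  rw [aux_sum hneg d hd f hf k]
  have := aux_rank d f k ((k : ℤ) - 1) (by ring)
  omega

end ConeMorse
end
end

section
/- (Polynomial form of the cone Morse inequalities.) Let n ≥ 1 and let (C^•, ∂) be a cochain complex of finite-dimensional real vector spaces with C^k = 0 unless 0 ≤ k ≤ 2n, and let f be a chain map of degree 2 on C^•. Set m_k = dim C^k, v_k = rank(f : C^k → C^{k+2}), and b_k^ω = dim H^k(Cone(f)). Then there exists a polynomial Q(s) with non-negative integer coefficients such that, as an identity of polynomials, (1+s)·∑_{k=0}^{2n} m_k s^k − (s+s²)·∑_{k=0}^{2n−2} v_k s^k = ∑_{k=0}^{2n+1} b_k^ω s^k + (1+s)·Q(s). -/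
noncomputable section

open Module

namespace ConeMorse

variable {C : ℤ → Type} [∀ k, AddCommGroup (C k)] [∀ k, Module ℝ (C k)]

lemma finrank_coho (C : ℤ → Type) [∀ k, AddCommGroup (C k)] [∀ k, Module ℝ (C k)]
    [∀ k, FiniteDimensional ℝ (C k)]
    (d : ∀ k, C k →ₗ[ℝ] C (k + 1)) (hd : ∀ k, (d (k + 1)).comp (d k) = 0) (k : ℤ) :
    finrank ℝ (coho C d k) + finrank ℝ (LinearMap.range (d k))
      + finrank ℝ (LinearMap.range (d (k - 1))) = finrank ℝ (C k) := by
  have hle : LinearMap.range (bmap d k) ≤ LinearMap.ker (d k) := by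
    rintro _ ⟨y, rfl⟩
    rw [LinearMap.mem_ker, bmap_apply, apply_lcast (ℓ := 1) d, lcast_eq_zero_iff]
    exact LinearMap.congr_fun (hd (k - 1)) y
  have h1 : finrank ℝ (coho C d k) +
      finrank ℝ ((LinearMap.range (bmap d k)).comap (LinearMap.ker (d k)).subtype)
      = finrank ℝ (LinearMap.ker (d k)) := Submodule.finrank_quotient_add_finrank
    ((LinearMap.range (bmap d k)).comap (LinearMap.ker (d k)).subtype)
  have h2 := LinearMap.finrank_range_add_finrank_ker (d k)
  have h3 : finrank ℝ ((LinearMap.range (bmap d k)).comap (LinearMap.ker (d k)).subtype)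
      = finrank ℝ (LinearMap.range (bmap d k)) :=
    (Submodule.comapSubtypeEquivOfLe hle).finrank_eq
  have hinj : ∀ {i j : ℤ} (h : i = j), Function.Injective (lcast (C := C) h) := by
    intro i j h; subst h; exact Function.injective_id
  have h4 : finrank ℝ (LinearMap.range (bmap d k)) = finrank ℝ (LinearMap.range (d (k - 1))) := by
    unfold bmap
    rw [LinearMap.range_comp]
    exact (Submodule.equivMapOfInjective _ (hinj _) _).finrank_eq.symm
  omega

lemma coneD_sq {C : ℤ → Type} [∀ k, AddCommGroup (C k)] [∀ k, Module ℝ (C k)]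
    (d : ∀ k, C k →ₗ[ℝ] C (k + 1)) (hd : ∀ k, (d (k + 1)).comp (d k) = 0)
    (f : ∀ k, C k →ₗ[ℝ] C (k + 2)) (hf : IsChainMap d f) (k : ℤ) :
    (coneD d f (k + 1)).comp (coneD d f k) = 0 := by
  apply LinearMap.ext
  rintro ⟨x, y⟩
  have hdd : ∀ i (z : C i), d (i + 1) (d i z) = 0 := fun i z => LinearMap.congr_fun (hd i) z
  have h := LinearMap.congr_fun (hf (k - 2 + 1)) y
  simp only [LinearMap.comp_apply] at h
  rw [LinearMap.comp_apply, coneD_apply, coneD_apply]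
  refine Prod.ext ?_ ?_
  · simp only [map_add, map_neg, hdd, zero_add, LinearMap.zero_apply, Prod.fst_zero]
    rw [apply_lcast (ℓ := 1) d, apply_lcast f, h, lcast_lcast, lcast_lcast, add_neg_cancel]
  · simp only [map_neg, LinearMap.zero_apply, Prod.snd_zero]
    rw [apply_lcast (ℓ := 1) d, hdd]
    simp

lemma rank_f_le {C : ℤ → Type} [∀ k, AddCommGroup (C k)] [∀ k, Module ℝ (C k)]
    [∀ k, FiniteDimensional ℝ (C k)]
    (d : ∀ k, C k →ₗ[ℝ] C (k + 1)) (f : ∀ k, C k →ₗ[ℝ] C (k + 2)) (k : ℤ) :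
    finrank ℝ (LinearMap.range (f (k - 1))) ≤ finrank ℝ (LinearMap.range (coneD d f k)) := by
  have key : ∀ j, j = k - 2 + 1 → finrank ℝ (LinearMap.range (f j)) ≤
      finrank ℝ (LinearMap.range (coneD d f k)) := by
    rintro _ rfl
    have hinj : ∀ {i j : ℤ} (h : i = j), Function.Injective (lcast (C := C) h) := by
      intro i j h; subst h; exact Function.injective_id
    have hh : k - 2 + 1 + 2 = k + 1 := by ring
    rw [(Submodule.equivMapOfInjective _ (hinj hh) (LinearMap.range (f (k - 2 + 1)))).finrank_eq]
    refine le_trans (Submodule.finrank_mono ?_)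
      (Submodule.finrank_map_le (LinearMap.fst ℝ (C (k + 1)) (C (k + 1 - 2 + 1))) _)
    rintro _ ⟨_, ⟨y, rfl⟩, rfl⟩
    refine ⟨coneD d f k (0, y), ⟨_, rfl⟩, ?_⟩
    rw [coneD_apply]
    simp
  exact key _ (by ring)

open Polynomial in
lemma coeff_sum_range (a : ℤ → ℤ) (N : ℕ) (ha : ∀ k : ℤ, (N : ℤ) ≤ k → a k = 0) (i : ℕ) :
    (∑ k ∈ Finset.range N, Polynomial.C (a (k : ℤ)) * X ^ k : ℤ[X]).coeff i = a i := by
  simp only [finsetSum_coeff, coeff_C_mul_X_pow]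
  rw [Finset.sum_ite_eq]
  split_ifs with h
  · rfl
  · exact (ha i (by simp at h; omega)).symm

open Polynomial in
lemma poly_identity (n : ℕ) (hn : 1 ≤ n) (M V R B : ℤ → ℤ)
    (hB : ∀ k, B k + R k + R (k - 1) = M k + M (k - 1))
    (hV : ∀ k, V (k - 1) ≤ R k)
    (hM : ∀ k : ℤ, (k < 0 ∨ 2 * (n : ℤ) < k) → M k = 0)
    (hV0 : ∀ k : ℤ, (k < 0 ∨ 2 * (n : ℤ) - 2 < k) → V k = 0)
    (hR : ∀ k : ℤ, (k < 0 ∨ 2 * (n : ℤ) < k) → R k = 0) :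
    ∃ Q : ℤ[X], (∀ i, 0 ≤ Q.coeff i) ∧
      (1 + X) * (∑ k ∈ Finset.range (2 * n + 1), Polynomial.C (M (k : ℤ)) * X ^ k)
        - (X + X ^ 2) * (∑ k ∈ Finset.range (2 * n - 1), Polynomial.C (V (k : ℤ)) * X ^ k)
      = (∑ k ∈ Finset.range (2 * n + 2), Polynomial.C (B (k : ℤ)) * X ^ k) + (1 + X) * Q := by
  have cM := coeff_sum_range M (2 * n + 1) (fun k hk => hM k (by push_cast at hk; omega))
  have cV := coeff_sum_range V (2 * n - 1) (fun k hk => hV0 k (by omega))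
  have cB := coeff_sum_range B (2 * n + 2) (fun k hk => by
    push_cast at hk
    have := hB k
    rw [hM k (by omega), hM (k - 1) (by omega), hR k (by omega), hR (k - 1) (by omega)] at this
    simpa using this)
  have cQ := coeff_sum_range (fun k => R k - V (k - 1)) (2 * n + 1) (fun k hk => by
    push_cast at hk
    rw [hR k (by omega), hV0 (k - 1) (by omega)]; rfl)
  refine ⟨∑ k ∈ Finset.range (2 * n + 1), Polynomial.C (R (k : ℤ) - V ((k : ℤ) - 1)) * X ^ k,
    fun i => ?_, ?_⟩
  · rw [cQ]; have := hV i; omega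
  · generalize (∑ k ∈ Finset.range (2 * n + 1), Polynomial.C (M (k : ℤ)) * X ^ k : ℤ[X]) = PM at *
    generalize (∑ k ∈ Finset.range (2 * n - 1), Polynomial.C (V (k : ℤ)) * X ^ k : ℤ[X]) = PV at *
    generalize (∑ k ∈ Finset.range (2 * n + 2), Polynomial.C (B (k : ℤ)) * X ^ k : ℤ[X]) = PB at *
    generalize (∑ k ∈ Finset.range (2 * n + 1),
      Polynomial.C (R (k : ℤ) - V ((k : ℤ) - 1)) * X ^ k : ℤ[X]) = PQ at *
    have e : (1 + X) * PM - (X + X ^ 2) * PV = PM + X * PM - X * PV - X * (X * PV) := by ring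
    have e' : PB + (1 + X) * PQ = PB + PQ + X * PQ := by ring
    rw [e, e']
    ext i
    rcases i with _ | _ | i
    · have h := hB 0
      have h1 := hM (0 - 1) (by omega)
      have h2 := hR (0 - 1) (by omega)
      have h3 := hV0 (0 - 1) (by omega)
      simp only [coeff_add, coeff_sub, coeff_X_mul_zero, cM, cV, cB, cQ, Nat.cast_zero]
      omega
    · have h := hB 1
      have h3 := hV0 (0 - 1) (by omega)
      simp only [coeff_add, coeff_sub, coeff_X_mul_zero, coeff_X_mul, cM, cV, cB, cQ,
        Nat.cast_zero, zero_add, Nat.cast_one, sub_self] at *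
      omega
    · have h := hB (i + 1 + 1)
      simp only [coeff_add, coeff_sub, coeff_X_mul, cM, cV, cB, cQ,
        Nat.cast_add, Nat.cast_one, add_sub_cancel_right] at *
      omega

open Polynomial in
/-- polynomial form of the cone Morse inequalities: for a degree `2` chain map
`f` on a cochain complex of finite-dimensional real vector spaces supported in degrees
`0 ≤ k ≤ 2n`, there is a polynomial `Q` with non-negative integer coefficients such that
`(1+s)·∑ m_k s^k − (s+s²)·∑ v_k s^k = ∑ b_k^ω s^k + (1+s)·Q(s)`. -/
theorem polynomial_cone_morse_inequalities
    (n : ℕ) (hn : 1 ≤ n)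
    (C : ℤ → Type) [∀ k, AddCommGroup (C k)] [∀ k, Module ℝ (C k)]
    [∀ k, FiniteDimensional ℝ (C k)]
    (hsupp : ∀ k : ℤ, (k < 0 ∨ 2 * (n : ℤ) < k) → Subsingleton (C k))
    (d : ∀ k, C k →ₗ[ℝ] C (k + 1)) (hd : ∀ k, (d (k + 1)).comp (d k) = 0)
    (f : ∀ k, C k →ₗ[ℝ] C (k + 2)) (hf : IsChainMap d f) :
    ∃ Q : Polynomial ℤ, (∀ i, 0 ≤ Q.coeff i) ∧
      (1 + X) * (∑ k ∈ Finset.range (2 * n + 1),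
          Polynomial.C (finrank ℝ (C (k : ℤ)) : ℤ) * X ^ k)
        - (X + X ^ 2) * (∑ k ∈ Finset.range (2 * n - 1),
          Polynomial.C (finrank ℝ ↥(LinearMap.range (f (k : ℤ))) : ℤ) * X ^ k)
      = (∑ k ∈ Finset.range (2 * n + 2),
          Polynomial.C (finrank ℝ (coho (coneX C 2) (coneD d f) (k : ℤ)) : ℤ) * X ^ k)
        + (1 + X) * Q := by
  have hz : ∀ k : ℤ, (k < 0 ∨ 2 * (n : ℤ) < k) → finrank ℝ (C k) = 0 := fun k hk => by
    have := hsupp k hk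
    exact finrank_zero_of_subsingleton
  refine poly_identity n hn (fun k => (finrank ℝ (C k) : ℤ))
    (fun k => (finrank ℝ ↥(LinearMap.range (f k)) : ℤ))
    (fun k => (finrank ℝ ↥(LinearMap.range (coneD d f k)) : ℤ))
    (fun k => (finrank ℝ (coho (coneX C 2) (coneD d f) k) : ℤ)) ?_ ?_ ?_ ?_ ?_
  · intro k
    have h := finrank_coho (coneX C 2) (coneD d f) (coneD_sq d hd f hf) k
    have h2 : finrank ℝ (coneX C 2 k) = finrank ℝ (C k) + finrank ℝ (C (k - 1)) := by
      rw [show k - 1 = k - 2 + 1 by ring]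
      exact finrank_prod
    rw [h2] at h
    exact_mod_cast h
  · intro k
    exact_mod_cast rank_f_le d f k
  · intro k hk
    exact_mod_cast hz k hk
  · intro k hk
    rcases hk with hk | hk
    · have := LinearMap.finrank_range_le (f k)
      have := hz k (by omega)
      omega
    · have := Submodule.finrank_le (LinearMap.range (f k))
      have := hz (k + 2) (by omega)
      omega
  · intro k hk
    rcases hk with hk | hk
    · have h := LinearMap.finrank_range_le (coneD d f k)
      have h2 : finrank ℝ (coneX C 2 k) = finrank ℝ (C k) + finrank ℝ (C (k - 2 + 1)) :=
        finrank_prod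
      rw [h2, hz k (by omega), hz (k - 2 + 1) (by omega)] at h
      omega
    · have h := Submodule.finrank_le (LinearMap.range (coneD d f k))
      have h2 : finrank ℝ (coneX C 2 (k + 1)) =
          finrank ℝ (C (k + 1)) + finrank ℝ (C (k + 1 - 2 + 1)) :=
        finrank_prod
      rw [h2, hz (k + 1) (by omega), hz (k + 1 - 2 + 1) (by omega)] at h
      omega

end ConeMorse
end
end

section
/- (Morse–Bott-type inequalities from the cokernel–kernel formula.) Let n ≥ 1 and let V_k (k ∈ ℤ) be finite-dimensional real vector spaces with V_k = 0 unless 0 ≤ k ≤ 2n, equipped with linear maps L : V_k → V_{k+2}. Let m_k be natural numbers with dim V_k ≤ m_k for all k (and m_k = 0 outside 0 ≤ k ≤ 2n). Define b_k^ω = dim coker(L : V_{k−2} → V_k) + dim ker(L : V_{k−1} → V_{k+1}). Then for every 0 ≤ k ≤ 2n+1: (weak) b_k^ω ≤ m_k + m_{k−1}, and (strong) ∑_{i=0}^{k} (−1)^{k−i} b_i^ω ≤ m_k. -/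
noncomputable section

open Module

/-- `b_k^ω = dim coker(L : V_{k-2} → V_k) + dim ker(L : V_{k-1} → V_{k+1})`. -/
def bOmega (V : ℤ → Type) [∀ k, AddCommGroup (V k)] [∀ k, Module ℝ (V k)]
    (L : ∀ k, V k →ₗ[ℝ] V (k + 2)) (k : ℤ) : ℕ :=
  finrank ℝ (V (k - 2 + 2) ⧸ LinearMap.range (L (k - 2)))
    + finrank ℝ ↥(LinearMap.ker (L (k - 1)))

/-- Morse–Bott-type inequalities from the cokernel–kernel formula:
if `V_k = 0` unless `0 ≤ k ≤ 2n`, `L : V_k → V_{k+2}` are linear maps, and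
`dim V_k ≤ m_k` with `m_k = 0` outside `0 ≤ k ≤ 2n`, then for `0 ≤ k ≤ 2n+1` one has the
weak inequality `b_k^ω ≤ m_k + m_{k-1}` and the strong inequality
`∑_{i=0}^{k} (-1)^{k-i} b_i^ω ≤ m_k`. -/
theorem morse_bott_type_inequalities
    (n : ℕ) (hn : 1 ≤ n)
    (V : ℤ → Type) [∀ k, AddCommGroup (V k)] [∀ k, Module ℝ (V k)]
    [∀ k, FiniteDimensional ℝ (V k)]
    (hsupp : ∀ k : ℤ, (k < 0 ∨ 2 * (n : ℤ) < k) → Subsingleton (V k))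
    (L : ∀ k, V k →ₗ[ℝ] V (k + 2))
    (m : ℤ → ℕ) (hm : ∀ k : ℤ, finrank ℝ (V k) ≤ m k)
    (hm0 : ∀ k : ℤ, (k < 0 ∨ 2 * (n : ℤ) < k) → m k = 0) :
    ∀ k : ℕ, k ≤ 2 * n + 1 →
      bOmega V L (k : ℤ) ≤ m (k : ℤ) + m ((k : ℤ) - 1) ∧
      ∑ i ∈ Finset.range (k + 1), (-1 : ℤ) ^ (k - i) * (bOmega V L (i : ℤ) : ℤ)
        ≤ (m (k : ℤ) : ℤ) := by
  have hb : ∀ k : ℤ, (bOmega V L k : ℤ) =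
      ((finrank ℝ (V k) : ℤ) - finrank ℝ (LinearMap.range (L (k - 1))))
      + ((finrank ℝ (V (k - 1)) : ℤ) - finrank ℝ (LinearMap.range (L (k - 2)))) := by
    intro k
    have h1 := Submodule.finrank_quotient_add_finrank (LinearMap.range (L (k - 2)))
    have h2 := LinearMap.finrank_range_add_finrank_ker (L (k - 1))
    have h3 : ∀ j : ℤ, j = k → finrank ℝ (V j) = finrank ℝ (V k) := by
      rintro _ rfl
      rfl
    have h4 := h3 (k - 2 + 2) (by ring)
    unfold bOmega
    push_cast
    omega
  have hneg : ∀ k : ℤ, k < 0 → finrank ℝ (V k) = 0 := by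
    intro k hk
    have := hm k
    have := hm0 k (Or.inl hk)
    omega
  have hS : ∀ k : ℕ, ∑ i ∈ Finset.range (k + 1), (-1 : ℤ) ^ (k - i) * (bOmega V L (i : ℤ) : ℤ)
      = (finrank ℝ (V (k : ℤ)) : ℤ) - finrank ℝ (LinearMap.range (L ((k : ℤ) - 1))) := by
    intro k
    induction k with
    | zero =>
      have h := hb ((0 : ℕ) : ℤ)
      have h1 := hneg (((0 : ℕ) : ℤ) - 1) (by norm_num)
      have h2 := hneg (((0 : ℕ) : ℤ) - 2) (by norm_num)
      have h3 := LinearMap.finrank_range_le (L (((0 : ℕ) : ℤ) - 2))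
      simp only [zero_add, Finset.range_one, Finset.sum_singleton, Nat.sub_self, pow_zero,
        one_mul]
      omega
    | succ k ih =>
      rw [Finset.sum_range_succ]
      have e : ∑ i ∈ Finset.range (k + 1), (-1 : ℤ) ^ (k + 1 - i) * (bOmega V L (i : ℤ) : ℤ)
          = - ∑ i ∈ Finset.range (k + 1), (-1 : ℤ) ^ (k - i) * (bOmega V L (i : ℤ) : ℤ) := by
        rw [← Finset.sum_neg_distrib]
        refine Finset.sum_congr rfl fun i hi => ?_
        have hi' := Finset.mem_range.mp hi
        rw [show k + 1 - i = (k - i) + 1 by omega, pow_succ]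
        ring
      rw [e, ih, hb, show ((k + 1 : ℕ) : ℤ) - 1 = k by push_cast; ring,
        show ((k + 1 : ℕ) : ℤ) - 2 = (k : ℤ) - 1 by push_cast; ring]
      simp only [Nat.sub_self, pow_zero]
      ring
  intro k _
  have h1 := hm k
  have h2 := hm ((k : ℤ) - 1)
  refine ⟨?_, ?_⟩
  · have := hb k
    omega
  · rw [hS]
    omega
end
end

section
/- (Cone cohomology dimensions in the hard Lefschetz case.) Let n ≥ 1 and let V_k (k ∈ ℤ) be finite-dimensional real vector spaces with V_k = 0 unless 0 ≤ k ≤ 2n, equipped with linear maps L : V_k → V_{k+2} such that for every 0 ≤ j ≤ n the composition L^{n−j} : V_j → V_{2n−j} is a linear isomorphism. Set b_k = dim V_k and b_k^ω = dim coker(L : V_{k−2} → V_k) + dim ker(L : V_{k−1} → V_{k+1}). Then b_k^ω = b_k − b_{k−2} for 0 ≤ k ≤ n, and b_k^ω = b_{k−1} − b_{k+1} for n+1 ≤ k ≤ 2n+1 (in particular b_{k−2} ≤ b_k for k ≤ n and b_{k+1} ≤ b_{k−1} for k ≥ n+1, so all differences are non-negative). -/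
noncomputable section

open Module

/-- Transport along an equality of degrees. -/
def lcast {V : ℤ → Type} [∀ k, AddCommGroup (V k)] [∀ k, Module ℝ (V k)]
    {i j : ℤ} (h : i = j) : V i →ₗ[ℝ] V j := by subst h; exact LinearMap.id

/-- The `m`-fold composition `L^m : V_k → V_{k+2m}` of the degree-`2` maps `L`. -/
def Lpow (V : ℤ → Type) [∀ k, AddCommGroup (V k)] [∀ k, Module ℝ (V k)]
    (L : ∀ k, V k →ₗ[ℝ] V (k + 2)) : (m : ℕ) → ∀ k : ℤ, V k →ₗ[ℝ] V (k + 2 * m)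
  | 0, k => lcast (by push_cast; ring)
  | (m + 1), k => (lcast (by push_cast; ring)).comp ((Lpow V L m (k + 2)).comp (L k))

theorem lcast_bij {V : ℤ → Type} [∀ k, AddCommGroup (V k)] [∀ k, Module ℝ (V k)]
    {i j : ℤ} (h : i = j) : Function.Bijective (lcast (V := V) h) := by
  subst h; exact Function.bijective_id

theorem L_surj_aux (V : ℤ → Type) [∀ k, AddCommGroup (V k)] [∀ k, Module ℝ (V k)]
    (L : ∀ k, V k →ₗ[ℝ] V (k + 2)) (m : ℕ) : ∀ (k i : ℤ), i = k + 2 * m →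
    Function.Surjective (Lpow V L (m + 1) k) → Function.Surjective (L i) := by
  induction m with
  | zero =>
    intro k i hi h
    obtain rfl : i = k := by simpa using hi
    rw [Lpow, Lpow, LinearMap.coe_comp, LinearMap.coe_comp] at h
    have h2 := Function.Surjective.of_comp_left h (lcast_bij _).1
    exact Function.Surjective.of_comp_left h2 (lcast_bij _).1
  | succ m ih =>
    intro k i hi h
    rw [Lpow, LinearMap.coe_comp, LinearMap.coe_comp] at h
    have h2 := Function.Surjective.of_comp_left h (lcast_bij _).1
    exact ih (k + 2) i (by rw [hi]; push_cast; ring) (Function.Surjective.of_comp h2)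

/-- cone cohomology dimensions in the hard Lefschetz case: if `V_k = 0`
unless `0 ≤ k ≤ 2n` and `L^{n-j} : V_j → V_{2n-j}` is an isomorphism for `0 ≤ j ≤ n`, then
with `b_k = dim V_k`, one has `b_k^ω = b_k - b_{k-2}` for `0 ≤ k ≤ n` and
`b_k^ω = b_{k-1} - b_{k+1}` for `n+1 ≤ k ≤ 2n+1`, all the differences being non-negative. -/
theorem hard_lefschetz_cone_dimensions
    (n : ℕ) (hn : 1 ≤ n)
    (V : ℤ → Type) [∀ k, AddCommGroup (V k)] [∀ k, Module ℝ (V k)]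
    [∀ k, FiniteDimensional ℝ (V k)]
    (hsupp : ∀ k : ℤ, (k < 0 ∨ 2 * (n : ℤ) < k) → Subsingleton (V k))
    (L : ∀ k, V k →ₗ[ℝ] V (k + 2))
    (hHL : ∀ j : ℕ, j ≤ n → Function.Bijective (Lpow V L (n - j) (j : ℤ))) :
    (∀ k : ℤ, 0 ≤ k → k ≤ (n : ℤ) →
      finrank ℝ (V (k - 2)) ≤ finrank ℝ (V k) ∧
      (bOmega V L k : ℤ) = (finrank ℝ (V k) : ℤ) - finrank ℝ (V (k - 2))) ∧
    (∀ k : ℤ, (n : ℤ) + 1 ≤ k → k ≤ 2 * (n : ℤ) + 1 →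
      finrank ℝ (V (k + 1)) ≤ finrank ℝ (V (k - 1)) ∧
      (bOmega V L k : ℤ) = (finrank ℝ (V (k - 1)) : ℤ) - finrank ℝ (V (k + 1))) := by
  have inj : ∀ k : ℤ, k ≤ n - 1 → Function.Injective (L k) := by
    intro k hk
    by_cases h0 : k < 0
    · have := hsupp k (Or.inl h0)
      exact Function.injective_of_subsingleton _
    · obtain ⟨j, rfl⟩ := Int.eq_ofNat_of_zero_le (not_lt.mp h0)
      have h := (hHL j (by omega)).1
      obtain ⟨m, hm⟩ : ∃ m, n - j = m + 1 := ⟨n - j - 1, by omega⟩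
      rw [hm, Lpow, LinearMap.coe_comp, LinearMap.coe_comp] at h
      exact Function.Injective.of_comp (Function.Injective.of_comp h)
  have surj : ∀ k : ℤ, (n : ℤ) - 1 ≤ k → Function.Surjective (L k) := by
    intro k hk
    by_cases h0 : 2 * (n : ℤ) < k + 2
    · have := hsupp (k + 2) (Or.inr h0)
      exact Function.surjective_to_subsingleton _
    · obtain ⟨j, hj⟩ := Int.eq_ofNat_of_zero_le (a := 2 * n - (k + 2)) (by omega)
      have h := (hHL j (by omega)).2
      obtain ⟨m, hm⟩ : ∃ m, n - j = m + 1 := ⟨n - j - 1, by omega⟩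
      rw [hm] at h
      exact L_surj_aux V L m j k (by omega) h
  have key : ∀ k : ℤ, (finrank ℝ (V (k + 2) ⧸ LinearMap.range (L k)) : ℤ)
      + finrank ℝ (LinearMap.range (L k)) = finrank ℝ (V (k + 2)) := fun k => by
    exact_mod_cast Submodule.finrank_quotient_add_finrank _
  have rn : ∀ k : ℤ, (finrank ℝ (LinearMap.range (L k)) : ℤ)
      + finrank ℝ (LinearMap.ker (L k)) = finrank ℝ (V k) := fun k => by
    exact_mod_cast LinearMap.finrank_range_add_finrank_ker _
  have ki : ∀ k : ℤ, k ≤ n - 1 → finrank ℝ (LinearMap.ker (L k)) = 0 := fun k hk => by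
    rw [LinearMap.ker_eq_bot.mpr (inj k hk)]; exact finrank_bot _ _
  have rs : ∀ k : ℤ, (n : ℤ) - 1 ≤ k →
      finrank ℝ (LinearMap.range (L k)) = finrank ℝ (V (k + 2)) := fun k hk => by
    rw [LinearMap.range_eq_top.mpr (surj k hk)]; exact finrank_top _ _
  constructor
  · intro k h0 hk
    have a := key (k - 2)
    have b := rn (k - 2)
    have c := ki (k - 2) (by omega)
    have d := ki (k - 1) (by omega)
    have e : finrank ℝ (V (k - 2 + 2)) = finrank ℝ (V k) := by rw [sub_add_cancel]
    unfold bOmega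
    omega
  · intro k h0 hk
    have a := key (k - 2)
    have b := rn (k - 1)
    have c := rs (k - 2) (by omega)
    have d := rs (k - 1) (by omega)
    have e : finrank ℝ (V (k - 1 + 2)) = finrank ℝ (V (k + 1)) := by
      rw [show k - 1 + 2 = k + 1 by ring]
    unfold bOmega
    omega
end
end

section
/- (Cochain-level Lefschetz refinement of the weak cone Morse inequalities.) Let n ≥ 1 and let (C^•, ∂) be a cochain complex of finite-dimensional real vector spaces with C^k = 0 unless 0 ≤ k ≤ 2n, and let f be a chain map of degree 2 on C^•. Assume that for every 0 ≤ j ≤ n the composition f^{n−j} : C^j → C^{2n−j} is a linear isomorphism. Set m_k = dim C^k and b_k^ω = dim H^k(Cone(f)). Then b_k^ω ≤ m_k − m_{k−2} for 0 ≤ k ≤ n, and b_k^ω ≤ m_{k−1} − m_{k+1} for n+1 ≤ k ≤ 2n+1. -/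
noncomputable section

open Module

namespace ConeMorse

variable {C : ℤ → Type} [∀ k, AddCommGroup (C k)] [∀ k, Module ℝ (C k)]

/-- The `m`-fold composition `f^m : C^k → C^{k+2m}` of the degree-`2` maps `f`. -/
def fpow (f : ∀ k, C k →ₗ[ℝ] C (k + 2)) : (m : ℕ) → ∀ k : ℤ, C k →ₗ[ℝ] C (k + 2 * m)
  | 0, k => lcast (by push_cast; ring)
  | (m + 1), k => (lcast (by push_cast; ring)).comp ((fpow f m (k + 2)).comp (f k))

lemma lcast_bij {i j : ℤ} (h : i = j) : Function.Bijective (lcast (C := C) h) := by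
  subst h; exact Function.bijective_id

lemma fpow_succ_apply (f : ∀ k, C k →ₗ[ℝ] C (k + 2)) (m : ℕ) (k : ℤ) (x : C k) :
    fpow f (m + 1) k x
      = lcast (by push_cast; ring) (fpow f m (k + 2) (f k x)) := rfl

lemma fpow_succ_factor (f : ∀ k, C k →ₗ[ℝ] C (k + 2)) (m : ℕ) : ∀ (k : ℤ) (x : C k),
    ∃ z : C (k + 2 * m), fpow f (m + 1) k x = lcast (by push_cast; ring) (f _ z) := by
  induction m with
  | zero =>
    intro k x
    refine ⟨lcast (by simp) x, ?_⟩
    rw [fpow_succ_apply, apply_lcast f, lcast_lcast]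
    show lcast _ (lcast _ _) = _
    rw [lcast_lcast]
  | succ m ih =>
    intro k x
    obtain ⟨z, hz⟩ := ih (k + 2) (f k x)
    refine ⟨lcast (by push_cast; ring) z, ?_⟩
    rw [fpow_succ_apply, hz, apply_lcast f, lcast_lcast, lcast_lcast]

lemma f_inj (n : ℕ) (hsupp : ∀ k : ℤ, (k < 0 ∨ 2 * (n : ℤ) < k) → Subsingleton (C k))
    (f : ∀ k, C k →ₗ[ℝ] C (k + 2))
    (hHL : ∀ j : ℕ, j ≤ n → Function.Bijective (fpow f (n - j) (j : ℤ)))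
    (j : ℤ) (hj : j < n) : Function.Injective (f j) := by
  by_cases h0 : j < 0
  · haveI := hsupp j (Or.inl h0)
    exact Function.injective_of_subsingleton _
  · lift j to ℕ using (by omega)
    have h := (hHL j (by omega)).1
    obtain ⟨m, hm⟩ : ∃ m, n - j = m + 1 := ⟨n - j - 1, by omega⟩
    rw [hm] at h
    intro a b hab
    apply h
    rw [fpow_succ_apply, fpow_succ_apply, hab]

lemma f_surj (n : ℕ) (hsupp : ∀ k : ℤ, (k < 0 ∨ 2 * (n : ℤ) < k) → Subsingleton (C k))
    (f : ∀ k, C k →ₗ[ℝ] C (k + 2))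
    (hHL : ∀ j : ℕ, j ≤ n → Function.Bijective (fpow f (n - j) (j : ℤ)))
    (j : ℤ) (hj : (n : ℤ) - 1 ≤ j) : Function.Surjective (f j) := by
  by_cases h0 : 2 * (n : ℤ) < j + 2
  · haveI := hsupp (j + 2) (Or.inr h0)
    exact Function.surjective_to_subsingleton _
  · obtain ⟨i, hi⟩ : ∃ i : ℕ, (i : ℤ) = 2 * n - j - 2 :=
      ⟨(2 * (n : ℤ) - j - 2).toNat, by omega⟩
    have h := (hHL i (by omega)).2
    obtain ⟨m, hm⟩ : ∃ m, n - i = m + 1 := ⟨n - i - 1, by omega⟩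
    rw [hm] at h
    intro y
    have e : j + 2 = (i : ℤ) + 2 * ((m + 1 : ℕ) : ℤ) := by push_cast; omega
    obtain ⟨x, hx⟩ := h (lcast e y)
    obtain ⟨z, hz⟩ := fpow_succ_factor f m i x
    refine ⟨lcast (by omega) z, (lcast_bij e).1 ?_⟩
    rw [apply_lcast f, lcast_lcast, ← hx, hz]

lemma cone_sq (d : ∀ k, C k →ₗ[ℝ] C (k + 1)) (hd : ∀ k, (d (k + 1)).comp (d k) = 0)
    (f : ∀ k, C k →ₗ[ℝ] C (k + 2)) (hf : IsChainMap d f) (k : ℤ) (w : coneX C 2 k) :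
    coneD d f (k + 1) (coneD d f k w) = 0 := by
  obtain ⟨x, y⟩ := w
  have hd' : ∀ k x, d (k + 1) (d k x) = 0 := fun k x => LinearMap.congr_fun (hd k) x
  have h := LinearMap.congr_fun (hf (k - 2 + 1)) y
  simp only [LinearMap.comp_apply] at h
  rw [coneD_apply, coneD_apply]
  refine Prod.ext ?_ ?_
  · simp only [map_add, map_neg, hd', apply_lcast (ℓ := 1) d, apply_lcast f, lcast_lcast, h]
    simp
  · simp only [map_neg, apply_lcast (ℓ := 1) d, hd', lcast_zero, neg_zero]
    rfl

lemma coho_finrank (X : ℤ → Type) [∀ k, AddCommGroup (X k)] [∀ k, Module ℝ (X k)]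
    [∀ k, FiniteDimensional ℝ (X k)]
    (D : ∀ k, X k →ₗ[ℝ] X (k + 1)) (hD : ∀ k x, D (k + 1) (D k x) = 0) (k : ℤ) :
    finrank ℝ (coho X D k) + finrank ℝ (LinearMap.range (D (k - 1)))
      + finrank ℝ (LinearMap.range (D k)) = finrank ℝ (X k) := by
  have h1 := LinearMap.finrank_range_add_finrank_ker (D k)
  have h2 := Submodule.finrank_quotient_add_finrank
    ((LinearMap.range (bmap D k)).comap (LinearMap.ker (D k)).subtype)
  have hle : LinearMap.range (bmap D k) ≤ LinearMap.ker (D k) := by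
    rintro _ ⟨x, rfl⟩
    rw [LinearMap.mem_ker, bmap_apply, apply_lcast (ℓ := 1) D, hD, lcast_zero]
  have h3 := (Submodule.comapSubtypeEquivOfLe hle).finrank_eq
  have h4 : finrank ℝ (LinearMap.range (bmap D k))
      = finrank ℝ (LinearMap.range (D (k - 1))) := by
    rw [bmap, LinearMap.range_comp]
    exact (LinearEquiv.ofBijective _ (lcast_bij (C := X) (show k - 1 + 1 = k by ring))).finrank_map_eq _
  change finrank ℝ (coho X D k) + _ = _ at h2
  omega

lemma cone_rank [∀ k, FiniteDimensional ℝ (C k)] (d : ∀ k, C k →ₗ[ℝ] C (k + 1))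
    (f : ∀ k, C k →ₗ[ℝ] C (k + 2)) (k : ℤ) :
    finrank ℝ (LinearMap.range (f (k - 2 + 1)))
      ≤ finrank ℝ (LinearMap.range (coneD d f k)) := by
  let g : coneX C 2 (k + 1) →ₗ[ℝ] C (k - 2 + 1 + 2) :=
    (lcast (show k + 1 = k - 2 + 1 + 2 by ring)).comp (LinearMap.fst ℝ _ _)
  have hle : LinearMap.range (f (k - 2 + 1)) ≤ (LinearMap.range (coneD d f k)).map g := by
    rintro _ ⟨y, rfl⟩
    refine ⟨_, ⟨((0 : C k), y), rfl⟩, ?_⟩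
    rw [coneD_apply]
    simp only [g, LinearMap.comp_apply, LinearMap.fst_apply, map_zero, zero_add, lcast_lcast]
    rfl
  exact (Submodule.finrank_mono hle).trans (Submodule.finrank_map_le _ _)

lemma finrank_cast {i j : ℤ} (h : i = j) : finrank ℝ (C i) = finrank ℝ (C j) := by rw [h]

/-- cochain-level Lefschetz refinement of the weak cone Morse inequalities:
if the complex is supported in degrees `0 ≤ k ≤ 2n` and the degree `2` chain map `f`
satisfies `f^{n-j} : C^j → C^{2n-j}` bijective for `0 ≤ j ≤ n`, then
`b_k^ω ≤ m_k - m_{k-2}` for `0 ≤ k ≤ n` and `b_k^ω ≤ m_{k-1} - m_{k+1}` for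
`n+1 ≤ k ≤ 2n+1`, where `m_k = dim C^k` and `b_k^ω = dim H^k(Cone f)`. -/
theorem lefschetz_weak_cone_morse_inequalities
    (n : ℕ) (hn : 1 ≤ n)
    (C : ℤ → Type) [∀ k, AddCommGroup (C k)] [∀ k, Module ℝ (C k)]
    [∀ k, FiniteDimensional ℝ (C k)]
    (hsupp : ∀ k : ℤ, (k < 0 ∨ 2 * (n : ℤ) < k) → Subsingleton (C k))
    (d : ∀ k, C k →ₗ[ℝ] C (k + 1)) (hd : ∀ k, (d (k + 1)).comp (d k) = 0)
    (f : ∀ k, C k →ₗ[ℝ] C (k + 2)) (hf : IsChainMap d f)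
    (hHL : ∀ j : ℕ, j ≤ n → Function.Bijective (fpow f (n - j) (j : ℤ))) :
    (∀ k : ℤ, 0 ≤ k → k ≤ (n : ℤ) →
      (finrank ℝ (coho (coneX C 2) (coneD d f) k) : ℤ)
        ≤ (finrank ℝ (C k) : ℤ) - finrank ℝ (C (k - 2))) ∧
    (∀ k : ℤ, (n : ℤ) + 1 ≤ k → k ≤ 2 * (n : ℤ) + 1 →
      (finrank ℝ (coho (coneX C 2) (coneD d f) k) : ℤ)
        ≤ (finrank ℝ (C (k - 1)) : ℤ) - finrank ℝ (C (k + 1))) := by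
  have key : ∀ k : ℤ, finrank ℝ (coho (coneX C 2) (coneD d f) k)
      + finrank ℝ (LinearMap.range (f (k - 1 - 2 + 1)))
      + finrank ℝ (LinearMap.range (f (k - 2 + 1)))
      ≤ finrank ℝ (C k) + finrank ℝ (C (k - 1)) := by
    intro k
    have h1 := coho_finrank (coneX C 2) (coneD d f) (cone_sq d hd f hf) k
    have h2 := cone_rank d f k
    have h3 := cone_rank d f (k - 1)
    have h4 : finrank ℝ (coneX C 2 k) = finrank ℝ (C k) + finrank ℝ (C (k - 2 + 1)) :=
      finrank_prod
    have h5 := finrank_cast (C := C) (show k - 2 + 1 = k - 1 by ring)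
    omega
  refine ⟨fun k _ hk => ?_, fun k hk _ => ?_⟩
  · have h := key k
    rw [LinearMap.finrank_range_of_inj (f_inj n hsupp f hHL _ (by omega)),
      LinearMap.finrank_range_of_inj (f_inj n hsupp f hHL _ (by omega)),
      finrank_cast (C := C) (show k - 2 + 1 = k - 1 by ring),
      finrank_cast (C := C) (show k - 1 - 2 + 1 = k - 2 by ring)] at h
    omega
  · have h := key k
    rw [LinearMap.range_eq_top.2 (f_surj n hsupp f hHL _ (by omega)),
      LinearMap.range_eq_top.2 (f_surj n hsupp f hHL _ (by omega)),
      finrank_top, finrank_top,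
      finrank_cast (C := C) (show k - 2 + 1 + 2 = k + 1 by ring),
      finrank_cast (C := C) (show k - 1 - 2 + 1 + 2 = k by ring)] at h
    omega

end ConeMorse
end
end

section
/- (Primitive cohomology dimensions of the four-torus via exterior algebra.) Let Λ^k = ⋀^k(ℝ^4) denote the k-th exterior power of ℝ^4 (with Λ^k = 0 for k < 0 or k > 4), let e₁, e₂, e₃, e₄ be the standard basis of ℝ^4, and let L : Λ^k → Λ^{k+2} be the linear map L(α) = (e₁∧e₂ + e₃∧e₄) ∧ α. Define b_k^ω = dim coker(L : Λ^{k−2} → Λ^k) + dim ker(L : Λ^{k−1} → Λ^{k+1}). Then (b_0^ω, b_1^ω, b_2^ω, b_3^ω, b_4^ω, b_5^ω) = (1, 4, 5, 5, 4, 1). -/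
noncomputable section

open Module ExteriorAlgebra

/-- `Λ^k = ⋀^k(ℝ^4)`, the `k`-th exterior power of `ℝ^4`, with `Λ^k = 0` for `k < 0`
(and automatically `Λ^k = 0` for `k > 4`). -/
def Lam (k : ℤ) : Submodule ℝ (ExteriorAlgebra ℝ (Fin 4 → ℝ)) :=
  if 0 ≤ k then ⋀[ℝ]^(k.toNat) (Fin 4 → ℝ) else ⊥

/-- The standard basis vectors `e₁, e₂, e₃, e₄` of `ℝ^4`. -/
def e (i : Fin 4) : Fin 4 → ℝ := Pi.single i 1

/-- The symplectic class `e₁∧e₂ + e₃∧e₄` in the exterior algebra. -/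
def omegaT4 : ExteriorAlgebra ℝ (Fin 4 → ℝ) :=
  ι ℝ (e 0) * ι ℝ (e 1) + ι ℝ (e 2) * ι ℝ (e 3)

lemma omegaT4_mul_mem {k : ℤ} : ∀ x ∈ Lam k, LinearMap.mulLeft ℝ omegaT4 x ∈ Lam (k + 2) := by
  intro x hx
  simp only [LinearMap.mulLeft_apply]
  by_cases hk : 0 ≤ k
  · have hk2 : 0 ≤ k + 2 := by omega
    simp only [Lam, if_pos hk, if_pos hk2] at hx ⊢
    have hω : omegaT4 ∈ (LinearMap.range (ι ℝ : (Fin 4 → ℝ) →ₗ[ℝ] _)) ^ 2 := by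
      rw [pow_two]
      exact add_mem
        (Submodule.mul_mem_mul (LinearMap.mem_range_self _ _) (LinearMap.mem_range_self _ _))
        (Submodule.mul_mem_mul (LinearMap.mem_range_self _ _) (LinearMap.mem_range_self _ _))
    have hmul := Submodule.mul_mem_mul hω hx
    rw [← pow_add] at hmul
    have htn : (k + 2).toNat = 2 + k.toNat := by omega
    rw [htn]
    exact hmul
  · simp only [Lam, if_neg hk, Submodule.mem_bot] at hx
    rw [hx, mul_zero]
    exact zero_mem _

/-- The map `L : Λ^k → Λ^{k+2}`, `α ↦ (e₁∧e₂ + e₃∧e₄) ∧ α`. -/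
def wedgeOmega (k : ℤ) : ↥(Lam k) →ₗ[ℝ] ↥(Lam (k + 2)) :=
  (LinearMap.mulLeft ℝ omegaT4).restrict omegaT4_mul_mem

/-- `b_k^ω = dim coker(L : Λ^{k-2} → Λ^k) + dim ker(L : Λ^{k-1} → Λ^{k+1})`. -/
def b13 (k : ℤ) : ℕ :=
  finrank ℝ (↥(Lam (k - 2 + 2)) ⧸ LinearMap.range (wedgeOmega (k - 2)))
    + finrank ℝ ↥(LinearMap.ker (wedgeOmega (k - 1)))

set_option linter.unusedSimpArgs false

lemma fin_ext (n : ℕ) : FiniteDimensional ℝ ↥(⋀[ℝ]^n (Fin 4 → ℝ)) := inferInstance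

instance finLam (k : ℤ) : FiniteDimensional ℝ ↥(Lam k) := by
  by_cases hk : 0 ≤ k
  · rw [Lam, if_pos hk]
    exact fin_ext _
  · rw [Lam, if_neg hk]
    infer_instance

lemma dim_nat (n : ℕ) : finrank ℝ ↥(Lam (n : ℤ)) = Nat.choose 4 n := by
  have h : Lam (n : ℤ) = ⋀[ℝ]^n (Fin 4 → ℝ) := by simp [Lam]
  rw [h, exteriorPower.finrank_eq]
  simp

lemma dim_neg (k : ℤ) (hk : k < 0) : finrank ℝ ↥(Lam k) = 0 := by
  have h : Lam k = ⊥ := by simp [Lam, hk]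
  rw [h, finrank_bot]

lemma b13_add (k i j : ℤ) (hi : i = k - 2) (hj : j = k - 1) :
    b13 k + finrank ℝ (LinearMap.range (wedgeOmega i))
      + finrank ℝ (LinearMap.range (wedgeOmega j))
      = finrank ℝ (Lam k) + finrank ℝ (Lam j) := by
  subst hi hj
  have h1 := Submodule.finrank_quotient_add_finrank (LinearMap.range (wedgeOmega (k - 2)))
  have h2 := LinearMap.finrank_range_add_finrank_ker (wedgeOmega (k - 1))
  have h3 : finrank ℝ (Lam (k - 2 + 2)) = finrank ℝ (Lam k) := by
    rw [sub_add_cancel]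
  unfold b13
  omega

lemma rank_le_src (k : ℤ) :
    finrank ℝ (LinearMap.range (wedgeOmega k)) ≤ finrank ℝ (Lam k) :=
  LinearMap.finrank_range_le _

lemma rank_le_tgt (k : ℤ) :
    finrank ℝ (LinearMap.range (wedgeOmega k)) ≤ finrank ℝ (Lam (k + 2)) :=
  Submodule.finrank_le _

lemma top_ne : ι ℝ (e 0) * (ι ℝ (e 1) * (ι ℝ (e 2) * ι ℝ (e 3))) ≠ 0 := by
  intro h
  have h1 : ιMulti ℝ 4 e = ι ℝ (e 0) * (ι ℝ (e 1) * (ι ℝ (e 2) * ι ℝ (e 3))) := by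
    rw [ιMulti_apply]
    simp [List.ofFn_succ]
  have h2 := liftAlternating_apply_ιMulti (R := ℝ) (M := Fin 4 → ℝ) (N := ℝ)
    (fun i => if hi : i = 4 then hi ▸ Matrix.detRowAlternating else 0) e
  rw [h1, h, map_zero] at h2
  have h3 : Matrix.det (fun i j => e i j) = (0 : ℝ) := h2.symm
  have h4 : (fun i j => e i j) = (1 : Matrix (Fin 4) (Fin 4) ℝ) := by
    ext i j
    simp [e, Matrix.one_apply, Pi.single_apply, eq_comm]
  rw [h4, Matrix.det_one] at h3
  exact one_ne_zero h3

lemma anti (v w : Fin 4 → ℝ) : ι ℝ v * ι ℝ w = - (ι ℝ w * ι ℝ v) :=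
  eq_neg_of_add_eq_zero_left (ι_add_mul_swap v w)

lemma anti' (v w : Fin 4 → ℝ) (x : ExteriorAlgebra ℝ (Fin 4 → ℝ)) :
    ι ℝ v * (ι ℝ w * x) = - (ι ℝ w * (ι ℝ v * x)) := by
  rw [← mul_assoc, anti, neg_mul, mul_assoc]

lemma sq' (v : Fin 4 → ℝ) (x : ExteriorAlgebra ℝ (Fin 4 → ℝ)) :
    ι ℝ v * (ι ℝ v * x) = 0 := by
  rw [← mul_assoc, ι_sq_zero, zero_mul]

lemma omega_sq : omegaT4 * omegaT4 =
    (2 : ℝ) • (ι ℝ (e 0) * (ι ℝ (e 1) * (ι ℝ (e 2) * ι ℝ (e 3)))) := by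
  simp only [omegaT4, mul_add, add_mul, mul_assoc, sq', ι_sq_zero, two_smul,
    anti (e 1) (e 0), anti (e 2) (e 0), anti (e 3) (e 0), anti (e 2) (e 1), anti (e 3) (e 1),
    anti (e 3) (e 2), anti' (e 1) (e 0), anti' (e 2) (e 0), anti' (e 3) (e 0), anti' (e 2) (e 1),
    anti' (e 3) (e 1), anti' (e 3) (e 2), mul_neg, neg_mul, neg_neg, mul_zero, neg_zero]
  abel

lemma omega_sq_ne : omegaT4 * omegaT4 ≠ 0 := by
  rw [omega_sq]
  exact smul_ne_zero two_ne_zero top_ne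

lemma omega_ne : omegaT4 ≠ 0 := fun h => omega_sq_ne (by rw [h, mul_zero])

lemma vec_eq (v : Fin 4 → ℝ) : v = v 0 • e 0 + v 1 • e 1 + v 2 • e 2 + v 3 • e 3 := by
  ext i
  fin_cases i <;> simp [e]

lemma omega_vec (v : Fin 4 → ℝ) (h : omegaT4 * ι ℝ v = 0) : v = 0 := by
  have key : ∀ j, omegaT4 * ι ℝ v * ι ℝ (e j) = 0 := fun j => by rw [h, zero_mul]
  rw [vec_eq v] at key
  have k0 := key 0
  have k1 := key 1
  have k2 := key 2
  have k3 := key 3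
  simp only [omegaT4, map_add, map_smul, mul_add, add_mul, mul_assoc, sq', ι_sq_zero,
    mul_smul_comm, smul_mul_assoc,
    anti (e 1) (e 0), anti (e 2) (e 0), anti (e 3) (e 0), anti (e 2) (e 1), anti (e 3) (e 1),
    anti (e 3) (e 2), anti' (e 1) (e 0), anti' (e 2) (e 0), anti' (e 3) (e 0), anti' (e 2) (e 1),
    anti' (e 3) (e 1), anti' (e 3) (e 2), mul_neg, neg_mul, neg_neg, mul_zero, neg_zero,
    smul_zero, add_zero, zero_add, smul_neg, neg_eq_zero, smul_eq_zero, top_ne, or_false]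
    at k0 k1 k2 k3
  ext i
  fin_cases i <;> simpa

lemma wedge_coe (k : ℤ) (x : Lam k) : (wedgeOmega k x : ExteriorAlgebra ℝ (Fin 4 → ℝ))
    = omegaT4 * x := rfl

lemma rank0 : finrank ℝ (LinearMap.range (wedgeOmega 0)) = 1 := by
  rw [LinearMap.finrank_range_of_inj]
  · simpa using dim_nat 0
  · rw [← LinearMap.ker_eq_bot, LinearMap.ker_eq_bot']
    rintro ⟨x, hx⟩ h
    have h' : omegaT4 * x = 0 := congrArg Subtype.val h
    have hx' : x ∈ (1 : Submodule ℝ (ExteriorAlgebra ℝ (Fin 4 → ℝ))) := by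
      simpa [Lam] using hx
    obtain ⟨r, rfl⟩ := Submodule.mem_one.1 hx'
    rw [← Algebra.commutes, ← Algebra.smul_def, smul_eq_zero] at h'
    have hr := h'.resolve_right omega_ne
    subst hr
    simp

lemma rank1 : finrank ℝ (LinearMap.range (wedgeOmega 1)) = 4 := by
  rw [LinearMap.finrank_range_of_inj]
  · simpa using dim_nat 1
  · rw [← LinearMap.ker_eq_bot, LinearMap.ker_eq_bot']
    rintro ⟨x, hx⟩ h
    have h' : omegaT4 * x = 0 := congrArg Subtype.val h
    have hx' : x ∈ LinearMap.range (ι ℝ : (Fin 4 → ℝ) →ₗ[ℝ] _) := by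
      simpa [Lam] using hx
    obtain ⟨v, rfl⟩ := hx'
    have hv := omega_vec v h'
    subst hv
    simp

lemma omega_mem : omegaT4 ∈ Lam 2 := by
  have h1 : (1 : ExteriorAlgebra ℝ (Fin 4 → ℝ)) ∈ Lam 0 := by
    simp [Lam]
  simpa using omegaT4_mul_mem (k := 0) 1 h1

lemma rank2 : finrank ℝ (LinearMap.range (wedgeOmega 2)) = 1 := by
  have h1 := rank_le_tgt 2
  have h2 : finrank ℝ (Lam (2 + 2)) = 1 := by simpa using dim_nat 4
  have h3 : finrank ℝ (LinearMap.range (wedgeOmega 2)) ≠ 0 := by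
    intro h
    rw [Submodule.finrank_eq_zero, LinearMap.range_eq_bot] at h
    have := congrArg Subtype.val (LinearMap.congr_fun h ⟨omegaT4, omega_mem⟩)
    exact omega_sq_ne this
  omega

/-- primitive cohomology dimensions of the four-torus via exterior algebra:
`(b_0^ω, b_1^ω, b_2^ω, b_3^ω, b_4^ω, b_5^ω) = (1, 4, 5, 5, 4, 1)`. -/
theorem primitive_cohomology_dimensions_T4 :
    b13 0 = 1 ∧ b13 1 = 4 ∧ b13 2 = 5 ∧ b13 3 = 5 ∧ b13 4 = 4 ∧ b13 5 = 1 := by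
  have a0 := b13_add 0 (-2) (-1) (by norm_num) (by norm_num)
  have a1 := b13_add 1 (-1) (0) (by norm_num) (by norm_num)
  have a2 := b13_add 2 (0) (1) (by norm_num) (by norm_num)
  have a3 := b13_add 3 (1) (2) (by norm_num) (by norm_num)
  have a4 := b13_add 4 (2) (3) (by norm_num) (by norm_num)
  have a5 := b13_add 5 (3) (4) (by norm_num) (by norm_num)
  have r0 := rank0
  have r1 := rank1
  have r2 := rank2
  have rm1 := rank_le_src (-1)
  have rm2 := rank_le_src (-2)
  have r3 : _ ≤ finrank ℝ (Lam 5) := rank_le_tgt 3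
  have r4 : _ ≤ finrank ℝ (Lam 6) := rank_le_tgt 4
  have dm1 := dim_neg (-1) (by norm_num)
  have dm2 := dim_neg (-2) (by norm_num)
  have d0 : finrank ℝ (Lam 0) = 1 := dim_nat 0
  have d1 : finrank ℝ (Lam 1) = 4 := dim_nat 1
  have d2 : finrank ℝ (Lam 2) = 6 := dim_nat 2
  have d3 : finrank ℝ (Lam 3) = 4 := dim_nat 3
  have d4 : finrank ℝ (Lam 4) = 1 := dim_nat 4
  have d5 : finrank ℝ (Lam 5) = 0 := dim_nat 5
  have d6 : finrank ℝ (Lam 6) = 0 := dim_nat 6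
  omega
end
end
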